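/- Let α = (φ,σ) be a minimal action of the infinite dihedral group ℤ⋊ℤ₂ on a Cantor set X. If the ℤ-action induced by φ is not minimal, then there exists a clopen set Y ⊆ X such that Y ∩ σ(Y) = ∅, Y ∪ σ(Y) = X, φ(Y) = Y, and the restriction φ|_Y is minimal (every φ-orbit of a point of Y is dense in Y). In particular, α is free. -/

import Mathlib

/-- The integer powers of a homeomorphism are continuous. -/
theorem Homeomorph.continuous_toEquiv_zpow {X : Type*} [TopologicalSpace X] (φ : X ≃ₜ X)
    (n : ℤ) : Continuous (φ.toEquiv ^ n : Equiv.Perm X) := by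
  have h : ∀ (m : ℕ) (ψ : X ≃ₜ X), Continuous (ψ.toEquiv ^ m : Equiv.Perm X) := fun m ψ => by
    induction m with
    | zero => exact continuous_id
    | succ k ih =>
      rw [pow_succ]
      exact ih.comp ψ.continuous
  obtain ⟨m, rfl | rfl⟩ := n.eq_nat_or_neg
  · rw [zpow_natCast]
    exact h m φ
  · rw [zpow_neg, ← inv_zpow, zpow_natCast]
    exact h m φ.symm

/-- A map conjugating a permutation to its inverse reverses its integer powers. -/
theorem Equiv.Perm.apply_zpow_of_conj_eq_inv {X : Type*} (f s : Equiv.Perm X)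
    (hs : ∀ x, s (s x) = x) (hrel : ∀ x, s (f (s x)) = f⁻¹ x) (n : ℤ) (x : X) :
    s ((f ^ n) x) = (f ^ (-n)) (s x) := by
  have h : SemiconjBy s f f⁻¹ := by
    ext y
    have := hrel (s y)
    rwa [hs] at this
  have h' := congrArg (fun g : Equiv.Perm X => g x) (h.zpow_right n)
  rwa [inv_zpow'] at h'

/-- The orbit of a point fixed by a nontrivial power of a permutation is finite. -/
theorem Equiv.Perm.finite_range_zpow_apply {X : Type*} (f : Equiv.Perm X) {n : ℤ} (hn : n ≠ 0)
    {x : X} (hx : (f ^ n) x = x) : (Set.range fun k : ℤ => (f ^ k) x).Finite := by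
  refine ((Set.finite_Ico (0 : ℤ) |n|).image fun k : ℤ => (f ^ k) x).subset ?_
  rintro _ ⟨k, rfl⟩
  refine ⟨k % n, ⟨Int.emod_nonneg k hn, Int.emod_lt_abs k hn⟩, ?_⟩
  have h : ((f ^ n) ^ (k / n)) x = x := Equiv.Perm.zpow_apply_eq_self_of_apply_eq_self hx _
  change (f ^ (k % n)) x = (f ^ k) x
  conv_rhs => rw [← Int.emod_add_mul_ediv k n, zpow_add, zpow_mul, Equiv.Perm.mul_apply, h]


/-- Let `α = (φ, σ)` be a minimal action of the infinite dihedral group `ℤ ⋊ ℤ₂` on a Cantor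
set `X`.  If the `ℤ`-action induced by `φ` is not minimal, then there is a clopen set `Y` with
`Y ∩ σ(Y) = ∅`, `Y ∪ σ(Y) = X`, `φ(Y) = Y` and `φ|_Y` minimal; in particular `α` is free. -/
theorem dihedral_minimal_phi_not_minimal {X : Type*} [TopologicalSpace X] [CompactSpace X]
    [TopologicalSpace.MetrizableSpace X] [TotallyDisconnectedSpace X] [PerfectSpace X]
    [Nonempty X] (φ σ : X ≃ₜ X)
    (hσ : ∀ x, σ (σ x) = x) (hrel : ∀ x, σ (φ (σ x)) = φ.symm x)
    (hmin : ∀ x : X,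
      Dense {y : X | ∃ (n : ℤ) (i : Bool), y = (φ.toEquiv ^ n) (cond i (σ x) x)})
    (hnot : ∃ x : X, ¬ Dense (Set.range fun n : ℤ => (φ.toEquiv ^ n) x)) :
    (∃ Y : Set X, IsClopen Y ∧ Y ∩ σ '' Y = ∅ ∧ Y ∪ σ '' Y = Set.univ ∧ φ '' Y = Y ∧
      (∀ x ∈ Y, Y ⊆ closure (Set.range fun n : ℤ => (φ.toEquiv ^ n) x))) ∧
    (∀ (n : ℤ) (i : Bool) (x : X),
      (φ.toEquiv ^ n) (cond i (σ x) x) = x → n = 0 ∧ i = false) := by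
  have hcont := φ.continuous_toEquiv_zpow
  have hσpow : ∀ (n : ℤ) (x : X), σ ((φ.toEquiv ^ n) x) = (φ.toEquiv ^ (-n)) (σ x) :=
    Equiv.Perm.apply_zpow_of_conj_eq_inv φ.toEquiv σ.toEquiv hσ hrel
  have hpow_add : ∀ (m n : ℤ) (x : X),
      (φ.toEquiv ^ m) ((φ.toEquiv ^ n) x) = (φ.toEquiv ^ (m + n)) x := fun m n x => by
    rw [zpow_add, Equiv.Perm.mul_apply]
  have horbit : ∀ x : X, {y : X | ∃ (n : ℤ) (i : Bool), y = (φ.toEquiv ^ n) (cond i (σ x) x)} =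
      (Set.range fun n : ℤ => (φ.toEquiv ^ n) x) ∪
        Set.range fun n : ℤ => (φ.toEquiv ^ n) (σ x) := fun x => by
    ext y
    simp [exists_or, eq_comm]
  set O : X → Set X := fun x => closure (Set.range fun n : ℤ => (φ.toEquiv ^ n) x)
  have hself : ∀ x, x ∈ O x := fun x => subset_closure ⟨0, rfl⟩
  have hpow : ∀ {x z : X} (n : ℤ), z ∈ O x → (φ.toEquiv ^ n) z ∈ O x := fun {x z} n hz => by
    refine map_mem_closure (hcont n) hz ?_
    rintro _ ⟨m, rfl⟩
    exact ⟨n + m, (hpow_add n m x).symm⟩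
  have hsub : ∀ {x z : X}, z ∈ O x → O z ⊆ O x := fun {x z} hz => by
    refine closure_minimal ?_ isClosed_closure
    rintro _ ⟨n, rfl⟩
    exact hpow n hz
  have hσO : ∀ {x z : X}, z ∈ O x → σ z ∈ O (σ x) := fun {x z} hz => by
    refine map_mem_closure σ.continuous hz ?_
    rintro _ ⟨m, rfl⟩
    exact ⟨-m, (hσpow m x).symm⟩
  have hcov : ∀ x y : X, y ∈ O x ∨ y ∈ O (σ x) := fun x y => by
    have h := hmin x y
    rwa [horbit, closure_union] at h
  obtain ⟨x₀, hx₀⟩ := hnot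
  have hσx₀ : σ x₀ ∉ O x₀ := fun h =>
    hx₀ fun y => (hcov x₀ y).elim id fun hy => hsub h hy
  have hY : ∀ z ∈ O x₀, O x₀ ⊆ O z := fun z hz => by
    rcases hcov z x₀ with h | h
    · exact hsub h
    · refine absurd (hsub hz ?_) hσx₀
      have := hσO h
      rwa [hσ] at this
  have hσY : ∀ z, σ z ∈ O x₀ ↔ z ∉ O x₀ := fun z => by
    constructor
    · intro h hz
      exact hσx₀ (hsub h (hσO (hY z hz (hself x₀))))
    · intro hz
      have := hσO ((hcov x₀ z).resolve_left hz)
      rwa [hσ] at this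
  have himage : σ '' O x₀ = (O x₀)ᶜ := by
    ext y
    constructor
    · rintro ⟨z, hz, rfl⟩ h
      exact (hσY z).1 h hz
    · exact fun hy => ⟨σ y, (hσY y).2 hy, hσ y⟩
  have hclosed : IsClosed (O x₀) := isClosed_closure
  refine ⟨⟨O x₀, ⟨hclosed, ?_⟩, ?_, ?_, ?_, hY⟩, ?_⟩
  · rw [← isClosed_compl_iff, ← himage]
    exact σ.isClosedMap _ hclosed
  · rw [himage, Set.inter_compl_self]
  · rw [himage, Set.union_compl_self]
  · ext y
    constructor
    · rintro ⟨z, hz, rfl⟩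
      have := hpow 1 hz
      rwa [zpow_one] at this
    · intro hy
      have := hpow (-1) hy
      rw [zpow_neg_one] at this
      exact ⟨_, this, φ.apply_symm_apply y⟩
  · rintro n (_ | _) x hx
    · refine ⟨?_, rfl⟩
      by_contra hn
      change (φ.toEquiv ^ n) x = x at hx
      have hσx : (φ.toEquiv ^ (-n)) (σ x) = σ x := by rw [← hσpow, hx]
      have hfin := (Equiv.Perm.finite_range_zpow_apply φ.toEquiv hn hx).union
        (Equiv.Perm.finite_range_zpow_apply φ.toEquiv (neg_ne_zero.2 hn) hσx)
      have huniv := (hmin x).closure_eq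
      rw [horbit, hfin.isClosed.closure_eq] at huniv
      exact infinite_of_mem_nhds x Filter.univ_mem (huniv ▸ hfin)
    · change (φ.toEquiv ^ n) (σ x) = x at hx
      have hx' : (φ.toEquiv ^ (-n)) x = σ x := by
        conv_lhs => rw [← hx, hpow_add, neg_add_cancel, zpow_zero, Equiv.Perm.one_apply]
      by_cases h : x ∈ O x₀
      · exact absurd h ((hσY x).1 (hx' ▸ hpow (-n) h))
      · have := hpow n ((hσY x).2 h)
        rw [hx] at this
        exact absurd this h
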